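/- Suppose that for each i = 1,…,n one has 0 < α_i < 1/(2L_i) and Σ_{k=0}^∞ 1/N_i(k) < ∞ almost surely. Then for almost every sample path, every cluster point x̂ of the sequence {x(k)} is a stationary point of problem (1), i.e., 0 ∈ ∇f̄(x̂) + ∂r(x̂), where ∂r denotes the subdifferential of the convex function r(x) = Σ_{i=1}^n r_i(x_i). -/

import Mathlib

open MeasureTheory ProbabilityTheory Real Finset
open scoped RealInnerProductSpace ENNReal

noncomputable section

/-- `y` is a proximal point of `u` for the function `r` (understood as extended by `+∞`
outside its compact effective domain `D`) with parameter `α`: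
`y ∈ argmin_{z ∈ D} ( r z + (1/(2α))‖z - u‖² )`. -/
def IsProxPt {E : Type*} [NormedAddCommGroup E]
    (r : E → ℝ) (D : Set E) (α : ℝ) (u y : E) : Prop :=
  y ∈ D ∧ ∀ z ∈ D, r y + 1 / (2 * α) * ‖y - u‖ ^ 2 ≤ r z + 1 / (2 * α) * ‖z - u‖ ^ 2


section det
set_option linter.unusedSectionVars false

variable {ι : Type*} [Fintype ι] [DecidableEq ι] {E : ι → Type*}
  [∀ i, NormedAddCommGroup (E i)] [∀ i, InnerProductSpace ℝ (E i)]
  [∀ i, FiniteDimensional ℝ (E i)] [∀ i, CompleteSpace (E i)]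

lemma aux_quad {f : (∀ i, E i) → ℝ} {g : (∀ i, E i) → ∀ i, E i} {D : ∀ i, Set (E i)} {L : ι → ℝ}
    (hDconv : ∀ i, Convex ℝ (D i))
    (hgrad : ∀ (u : ∀ i, E i) (i : ι),
      HasGradientAt (fun t => f (Function.update u i t)) (g u i) (u i))
    (hLpos : ∀ i, 0 < L i)
    (hsmooth : ∀ (u : ∀ i, E i), (∀ j, u j ∈ D j) →
      ∀ i, ∀ ui' ∈ D i, ‖g u i - g (Function.update u i ui') i‖ ≤ L i * ‖u i - ui'‖)
    (u : ∀ i, E i) (hu : ∀ j, u j ∈ D j) (i : ι) (y : E i) (hy : y ∈ D i) :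
    |f (Function.update u i y) - f u - ⟪g u i, y - u i⟫| ≤ L i * ‖y - u i‖ ^ 2 := by
  have hd : ∀ t : E i, HasFDerivAt (fun s => f (Function.update u i s) - ⟪g u i, s⟫)
      (innerSL ℝ (g (Function.update u i t) i) - innerSL ℝ (g u i)) t := by
    intro t
    have h1 := (hgrad (Function.update u i t) i).hasFDerivAt
    simp only [Function.update_idem, Function.update_self] at h1
    have h2 : HasFDerivAt (fun s : E i => ⟪g u i, s⟫) (innerSL ℝ (g u i)) t :=
      (innerSL ℝ (g u i)).hasFDerivAt
    exact h1.sub h2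
  have key := Convex.norm_image_sub_le_of_norm_hasFDerivWithin_le
    (f := fun s => f (Function.update u i s) - ⟪g u i, s⟫)
    (f' := fun t => innerSL ℝ (g (Function.update u i t) i) - innerSL ℝ (g u i))
    (s := segment ℝ (u i) y) (C := L i * ‖y - u i‖)
    (x := u i) (y := y)
    (fun t _ => (hd t).hasFDerivWithinAt) ?_ (convex_segment _ _)
    (left_mem_segment _ _ _) (right_mem_segment _ _ _)
  · simp only [Function.update_eq_self, Real.norm_eq_abs] at key
    rw [inner_sub_right]
    calc _ = _ := by congr 1; ring
      _ ≤ _ := key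
      _ = _ := by ring
  · intro t ht
    have htD : t ∈ D i := (hDconv i).segment_subset (hu i) hy ht
    rw [← map_sub, innerSL_apply_norm, norm_sub_rev]
    refine (hsmooth u hu i t htD).trans ?_
    have : ‖u i - t‖ ≤ ‖y - u i‖ := by
      rw [norm_sub_rev, ← dist_eq_norm, ← dist_eq_norm]
      have := dist_add_dist_of_mem_segment ht
      rw [dist_comm t, dist_comm y]
      linarith [dist_nonneg (x := t) (y := y)]
    exact mul_le_mul_of_nonneg_left this (hLpos i).le

/-- uniform bound for a family of functionals bounded on differences -/
lemma aux_bs {E : Type*} [NormedAddCommGroup E] [InnerProductSpace ℝ E] [FiniteDimensional ℝ E]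
    {κ : Type*} (G : κ → E) (D : Set E) (t0 : E)
    (h : ∀ z ∈ D, ∃ C, ∀ a, |⟪G a, z - t0⟫| ≤ C) :
    ∃ K, 0 ≤ K ∧ ∀ a, ∀ z ∈ D, ∀ t ∈ D, |⟪G a, z - t⟫| ≤ K * ‖z - t‖ := by
  let V : Submodule ℝ E := Submodule.span ℝ ((fun z => z - t0) '' D)
  have hV : ∀ v ∈ V, ∃ C, ∀ a, |⟪G a, v⟫| ≤ C := by
    intro v hv
    induction hv using Submodule.span_induction with
    | mem x hx => obtain ⟨z, hz, rfl⟩ := hx; exact h z hz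
    | zero => exact ⟨0, fun a => by simp⟩
    | add x y _ _ hx hy =>
      obtain ⟨C1, h1⟩ := hx
      obtain ⟨C2, h2⟩ := hy
      refine ⟨C1 + C2, fun a => ?_⟩
      rw [inner_add_right]
      exact (abs_add_le _ _).trans (add_le_add (h1 a) (h2 a))
    | smul c x _ hx =>
      obtain ⟨C1, h1⟩ := hx
      refine ⟨|c| * C1, fun a => ?_⟩
      rw [inner_smul_right, abs_mul]
      exact mul_le_mul_of_nonneg_left (h1 a) (abs_nonneg _)
  have : CompleteSpace V := FiniteDimensional.complete ℝ V
  obtain ⟨K, hK⟩ := banach_steinhaus (g := fun a => (innerSL ℝ (G a)).comp V.subtypeL) (by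
    intro v
    obtain ⟨C, hC⟩ := hV v v.2
    exact ⟨C, fun a => by simpa using hC a⟩)
  refine ⟨max K 0, le_max_right _ _, fun a z hz t ht => ?_⟩
  have hm : z - t ∈ V := by
    have h1 : z - t0 ∈ V := Submodule.subset_span ⟨z, hz, rfl⟩
    have h2 : t - t0 ∈ V := Submodule.subset_span ⟨t, ht, rfl⟩
    simpa using V.sub_mem h1 h2
  have := ((innerSL ℝ (G a)).comp V.subtypeL).le_opNorm ⟨z - t, hm⟩
  simp only [ContinuousLinearMap.comp_apply, Submodule.subtypeL_apply, innerSL_apply_apply,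
    Real.norm_eq_abs] at this
  refine this.trans ?_
  have h3 := (hK a).trans (le_max_left K 0)
  exact mul_le_mul_of_nonneg_right h3 (norm_nonneg _)

lemma aux_diam {E : Type*} [NormedAddCommGroup E] {D : Set E} (h : IsCompact D) :
    ∃ R, 0 ≤ R ∧ ∀ z ∈ D, ∀ t ∈ D, ‖z - t‖ ≤ R := by
  obtain ⟨R, hR⟩ := h.isBounded.exists_norm_le
  refine ⟨max (R + R) 0, le_max_right _ _, fun z hz t ht => ?_⟩
  exact (norm_sub_le _ _).trans ((add_le_add (hR z hz) (hR t ht)).trans (le_max_left _ _))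

lemma aux_bdd {f : (∀ i, E i) → ℝ} {g : (∀ i, E i) → ∀ i, E i} {D : ∀ i, Set (E i)} {L : ι → ℝ}
    (hDcomp : ∀ i, IsCompact (D i)) (hLpos : ∀ i, 0 < L i)
    (hq : ∀ (u : ∀ i, E i), (∀ j, u j ∈ D j) → ∀ i, ∀ y ∈ D i,
      |f (Function.update u i y) - f u - ⟪g u i, y - u i⟫| ≤ L i * ‖y - u i‖ ^ 2)
    (S : Finset ι) : ∀ b : ∀ i, E i, (∀ j, b j ∈ D j) →
      ∃ C, ∀ v : ∀ i, E i, (∀ j, v j ∈ D j) → (∀ j, j ∉ S → v j = b j) → |f v| ≤ C := by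
  induction S using Finset.induction_on with
  | empty =>
    intro b hb
    refine ⟨|f b|, fun v _ hv => ?_⟩
    have : v = b := funext fun j => hv j (by simp)
    rw [this]
  | insert i S hi ih =>
    intro b hb
    obtain ⟨R, hR0, hR⟩ := aux_diam (hDcomp i)
    have hupd : ∀ v : ∀ i, E i, (∀ j, v j ∈ D j) → ∀ t ∈ D i,
        ∀ j, Function.update v i t j ∈ D j := by
      intro v hv t ht j
      by_cases h : j = i
      · subst h; simpa using ht
      · simpa [h] using hv j
    -- bound with i-th block frozen
    have hfr : ∀ t ∈ D i, ∃ C, ∀ v : ∀ i, E i, (∀ j, v j ∈ D j) →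
        (∀ j, j ∉ insert i S → v j = b j) → |f (Function.update v i t)| ≤ C := by
      intro t ht
      obtain ⟨C, hC⟩ := ih (Function.update b i t) (hupd b hb t ht)
      refine ⟨C, fun v hv hvb => hC _ (hupd v hv t ht) fun j hj => ?_⟩
      by_cases h : j = i
      · subst h; simp
      · simpa [h] using hvb j (by simp [h, hj])
    let κ := {v : ∀ i, E i // (∀ j, v j ∈ D j) ∧ (∀ j, j ∉ insert i S → v j = b j)}
    obtain ⟨C0, hC0⟩ := hfr (b i) (hb i)
    obtain ⟨K, hK0, hK⟩ := aux_bs (fun v : κ => g (Function.update v.1 i (b i)) i) (D i) (b i) (by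
      intro z hz
      obtain ⟨C, hC⟩ := hfr z hz
      refine ⟨C + C0 + L i * ‖z - b i‖ ^ 2, fun v => ?_⟩
      have h1 := hq _ (hupd v.1 v.2.1 (b i) (hb i)) i z hz
      have h2 := hC v.1 v.2.1 v.2.2
      have h3 := hC0 v.1 v.2.1 v.2.2
      simp only [Function.update_idem, Function.update_self] at h1
      rw [abs_le] at *
      constructor <;> linarith [h1.1, h1.2, h2.1, h2.2, h3.1, h3.2])
    refine ⟨C0 + K * R + L i * R ^ 2, fun v hv hvb => ?_⟩
    have h1 := hq _ (hupd v hv (b i) (hb i)) i (v i) (hv i)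
    have h3 := hC0 v hv hvb
    have h4 := hK ⟨v, hv, hvb⟩ (v i) (hv i) (b i) (hb i)
    simp only [Function.update_idem, Function.update_self, Function.update_eq_self] at h1 h4
    have h5 := hR (v i) (hv i) (b i) (hb i)
    have h6 : L i * ‖v i - b i‖ ^ 2 ≤ L i * R ^ 2 := by
      have := (hLpos i).le
      gcongr
    have h7 : K * ‖v i - b i‖ ≤ K * R := by gcongr
    rw [abs_le] at *
    constructor <;> linarith [h1.1, h1.2, h4.1, h4.2, h3.1, h3.2]

lemma aux_upd {D : ∀ i, Set (E i)} {v : ∀ i, E i} (hv : ∀ j, v j ∈ D j) {i : ι} {t : E i}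
    (ht : t ∈ D i) (j : ι) : Function.update v i t j ∈ D j := by
  by_cases h : j = i
  · subst h; simpa using ht
  · simpa [h] using hv j

lemma aux_lip1 {f : (∀ i, E i) → ℝ} {g : (∀ i, E i) → ∀ i, E i} {D : ∀ i, Set (E i)} {L : ι → ℝ}
    (hDcomp : ∀ i, IsCompact (D i)) (hDne : ∀ i, (D i).Nonempty) (hLpos : ∀ i, 0 < L i)
    (hsmooth : ∀ (u : ∀ i, E i), (∀ j, u j ∈ D j) →
      ∀ i, ∀ ui' ∈ D i, ‖g u i - g (Function.update u i ui') i‖ ≤ L i * ‖u i - ui'‖)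
    (hq : ∀ (u : ∀ i, E i), (∀ j, u j ∈ D j) → ∀ i, ∀ y ∈ D i,
      |f (Function.update u i y) - f u - ⟪g u i, y - u i⟫| ≤ L i * ‖y - u i‖ ^ 2) (i : ι) :
    ∃ K, 0 ≤ K ∧ ∀ u : ∀ i, E i, (∀ j, u j ∈ D j) → ∀ y ∈ D i,
      |⟪g u i, y - u i⟫| ≤ K * ‖y - u i‖ ∧ |f (Function.update u i y) - f u| ≤ K * ‖y - u i‖ := by
  choose b hb using hDne
  obtain ⟨M, hM⟩ := aux_bdd hDcomp hLpos hq Finset.univ b hb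
  replace hM : ∀ v : ∀ i, E i, (∀ j, v j ∈ D j) → |f v| ≤ M := fun v hv => hM v hv (by simp)
  obtain ⟨R, hR0, hR⟩ := aux_diam (hDcomp i)
  obtain ⟨K, hK0, hK⟩ := aux_bs
    (fun v : {v : ∀ i, E i // ∀ j, v j ∈ D j} => g (Function.update v.1 i (b i)) i)
    (D i) (b i) (by
      intro z hz
      refine ⟨M + M + L i * ‖z - b i‖ ^ 2, fun v => ?_⟩
      have h1 := hq _ (aux_upd v.2 (hb i)) i z hz
      have h2 := hM _ (aux_upd v.2 hz)
      have h3 := hM _ (aux_upd v.2 (hb i))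
      simp only [Function.update_idem, Function.update_self] at h1
      rw [abs_le] at *
      constructor <;> linarith [h1.1, h1.2, h2.1, h2.2, h3.1, h3.2])
  have hL := (hLpos i).le
  refine ⟨K + L i * R + L i * R, by positivity, fun u hu y hy => ?_⟩
  have h1 := hK ⟨u, hu⟩ y hy (u i) (hu i)
  have h2 := hsmooth u hu i (b i) (hb i)
  have h3 : |⟪g u i - g (Function.update u i (b i)) i, y - u i⟫| ≤ L i * R * ‖y - u i‖ := by
    refine (abs_real_inner_le_norm _ _).trans ?_
    have := hR _ (hu i) _ (hb i)
    have h4 : L i * ‖u i - b i‖ ≤ L i * R := by gcongr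
    exact mul_le_mul_of_nonneg_right (h2.trans h4) (norm_nonneg _)
  have h5 : |⟪g u i, y - u i⟫| ≤ (K + L i * R) * ‖y - u i‖ := by
    rw [inner_sub_left] at h3
    simp only at h1
    rw [abs_le] at *
    constructor <;> linarith [h1.1, h1.2, h3.1, h3.2]
  have h6 := hq u hu i y hy
  have h7 : L i * ‖y - u i‖ ^ 2 ≤ L i * R * ‖y - u i‖ := by
    rw [sq, ← mul_assoc]
    have := hR _ hy _ (hu i)
    gcongr
  have h8 : 0 ≤ L i * R * ‖y - u i‖ := by positivity
  constructor
  · linarith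
  · rw [abs_le] at *
    constructor <;> linarith [h5.1, h5.2, h6.1, h6.2]

lemma aux_lip {f : (∀ i, E i) → ℝ} {D : ∀ i, Set (E i)} {K : ι → ℝ}
    (hK : ∀ i, ∀ u : ∀ i, E i, (∀ j, u j ∈ D j) → ∀ y ∈ D i,
      |f (Function.update u i y) - f u| ≤ K i * ‖y - u i‖)
    (u v : ∀ i, E i) (hu : ∀ j, u j ∈ D j) (hv : ∀ j, v j ∈ D j) :
    |f u - f v| ≤ ∑ i, K i * ‖u i - v i‖ := by
  have hmem : ∀ S : Finset ι, ∀ j, S.piecewise u v j ∈ D j := by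
    intro S j
    by_cases h : j ∈ S <;> simp [h, hu, hv]
  have key : ∀ S : Finset ι, |f (S.piecewise u v) - f v| ≤ ∑ i ∈ S, K i * ‖u i - v i‖ := by
    intro S
    induction S using Finset.induction_on with
    | empty => simp
    | insert i S hi ih =>
      rw [Finset.sum_insert hi, Finset.piecewise_insert]
      have := hK i (S.piecewise u v) (hmem S) (u i) (hu i)
      rw [Finset.piecewise_eq_of_notMem _ _ _ hi] at this
      rw [abs_le] at *
      constructor <;> linarith [this.1, this.2, ih.1, ih.2]
  simpa using key Finset.univ


lemma aux_gradlim {f : (∀ i, E i) → ℝ} {g : (∀ i, E i) → ∀ i, E i} {D : ∀ i, Set (E i)}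
    {L K : ι → ℝ}
    (hDconv : ∀ i, Convex ℝ (D i)) (hDcomp : ∀ i, IsCompact (D i)) (hLpos : ∀ i, 0 < L i)
    (hq : ∀ (u : ∀ i, E i), (∀ j, u j ∈ D j) → ∀ i, ∀ y ∈ D i,
      |f (Function.update u i y) - f u - ⟪g u i, y - u i⟫| ≤ L i * ‖y - u i‖ ^ 2)
    (hlip : ∀ u v : ∀ i, E i, (∀ j, u j ∈ D j) → (∀ j, v j ∈ D j) →
      |f u - f v| ≤ ∑ i, K i * ‖u i - v i‖)
    (u : ℕ → ∀ i, E i) (v : ∀ i, E i) (hu : ∀ k j, u k j ∈ D j) (hv : ∀ j, v j ∈ D j)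
    (huv : Filter.Tendsto u Filter.atTop (nhds v)) (i : ι) (z : E i) (hz : z ∈ D i) :
    Filter.Tendsto (fun k => ⟪g (u k) i, z - u k i⟫) Filter.atTop (nhds ⟪g v i, z - v i⟫) := by
  obtain ⟨R, hR0, hR⟩ := aux_diam (hDcomp i)
  have hf : ∀ (a : ℕ → ∀ i, E i) (b : ∀ i, E i), (∀ k j, a k j ∈ D j) → (∀ j, b j ∈ D j) →
      Filter.Tendsto a Filter.atTop (nhds b) →
      Filter.Tendsto (fun k => f (a k)) Filter.atTop (nhds (f b)) := by
    intro a b ha hb hab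
    rw [tendsto_iff_dist_tendsto_zero]
    refine squeeze_zero (g := fun k => ∑ i, K i * ‖a k i - b i‖) (fun _ => dist_nonneg)
      (fun k => by rw [Real.dist_eq]; exact hlip _ _ (ha k) hb) ?_
    have : Filter.Tendsto (fun k => ∑ i, K i * ‖a k i - b i‖) Filter.atTop
        (nhds (∑ i, K i * ‖b i - b i‖)) := by
      refine tendsto_finsetSum _ fun j _ => ?_
      exact (((tendsto_pi_nhds.1 hab j).sub_const _).norm).const_mul _
    simpa using this
  rw [Metric.tendsto_atTop']
  intro ε hε
  have hL := hLpos i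
  -- choose t
  obtain ⟨t, ht0, ht1, ht⟩ : ∃ t : ℝ, 0 < t ∧ t ≤ 1 ∧ 2 * L i * R ^ 2 * t < ε / 2 := by
    refine ⟨min 1 (ε / (2 * (2 * L i * R ^ 2 + 1))), by positivity, min_le_left _ _, ?_⟩
    have h1 : 2 * L i * R ^ 2 * min 1 (ε / (2 * (2 * L i * R ^ 2 + 1))) ≤
        2 * L i * R ^ 2 * (ε / (2 * (2 * L i * R ^ 2 + 1))) := by
      gcongr
      exact min_le_right _ _
    refine h1.trans_lt ?_
    rw [mul_div_assoc', div_lt_div_iff₀ (by positivity) (by positivity)]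
    nlinarith
  let y : (∀ i, E i) → E i := fun a => a i + t • (z - a i)
  have hyD : ∀ a : ∀ i, E i, (∀ j, a j ∈ D j) → y a ∈ D i := fun a ha =>
    (hDconv i).add_smul_sub_mem (ha i) hz ⟨ht0.le, ht1⟩
  have hquad : ∀ a : ∀ i, E i, (∀ j, a j ∈ D j) →
      |f (Function.update a i (y a)) - f a - t * ⟪g a i, z - a i⟫| ≤ L i * (t ^ 2 * R ^ 2) := by
    intro a ha
    have h1 := hq a ha i (y a) (hyD a ha)
    have h2 : y a - a i = t • (z - a i) := by simp [y]
    rw [h2, inner_smul_right, norm_smul, Real.norm_eq_abs, mul_pow, sq_abs] at h1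
    refine h1.trans ?_
    have := hR z hz (a i) (ha i)
    gcongr
  have c1 := hf u v hu hv huv
  have c2 := hf (fun k => Function.update (u k) i (y (u k))) (Function.update v i (y v))
    (fun k => aux_upd (hu k) (hyD _ (hu k))) (aux_upd hv (hyD _ hv)) (by
      have hc : Continuous (fun a : ∀ i, E i => Function.update a i (y a)) := by
        apply Continuous.update continuous_id
        simp only [y]
        fun_prop
      exact (hc.tendsto v).comp huv)
  have c3 := c2.sub c1
  rw [Metric.tendsto_atTop'] at c3
  obtain ⟨n0, hn0⟩ := c3 (t * (ε / 2)) (by positivity)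
  refine ⟨n0, fun k hk => ?_⟩
  have e1 := hn0 k hk
  have e2 := hquad (u k) (hu k)
  have e3 := hquad v hv
  rw [Real.dist_eq] at *
  have e4 : t * |⟪g (u k) i, z - u k i⟫ - ⟪g v i, z - v i⟫| < t * ε := by
    rw [← abs_of_pos ht0, ← abs_mul, abs_of_pos ht0, mul_sub]
    have e5 : 2 * (L i * (t ^ 2 * R ^ 2)) < t * (ε / 2) := by
      calc _ = t * (2 * L i * R ^ 2 * t) := by ring
        _ < _ := by gcongr
    rw [abs_le] at e2 e3
    rw [abs_lt] at *
    constructor <;> linarith [e1.1, e1.2, e2.1, e2.2, e3.1, e3.2]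
  exact lt_of_mul_lt_mul_left e4 ht0.le

lemma aux_prox {E : Type*} [NormedAddCommGroup E] [InnerProductSpace ℝ E]
    {r : E → ℝ} {D : Set E} {α : ℝ} (hα : 0 < α) {u g w y : E}
    (h : IsProxPt r D α (u - α • (g + w)) y) (z : E) (hz : z ∈ D) :
    r y + ⟪g, y - u⟫ + ⟪w, y - u⟫ + 1 / (2 * α) * ‖y - u‖ ^ 2 ≤
      r z + ⟪g, z - u⟫ + ⟪w, z - u⟫ + 1 / (2 * α) * ‖z - u‖ ^ 2 := by
  have h1 := h.2 z hz
  have e : ∀ a : E, 1 / (2 * α) * ‖a - (u - α • (g + w))‖ ^ 2 =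
      1 / (2 * α) * ‖a - u‖ ^ 2 + ⟪g, a - u⟫ + ⟪w, a - u⟫ + α / 2 * ‖g + w‖ ^ 2 := by
    intro a
    have : a - (u - α • (g + w)) = (a - u) + α • (g + w) := by abel
    rw [this, norm_add_sq_real, inner_smul_right, norm_smul, Real.norm_eq_abs, abs_of_pos hα,
      inner_add_right, real_inner_comm g, real_inner_comm w]
    field_simp
    ring
  rw [e, e] at h1
  linarith

lemma aux_var {E : Type*} [NormedAddCommGroup E] [InnerProductSpace ℝ E]
    {r : E → ℝ} {D : Set E} {c : ℝ} {u g : E} (hr : ConvexOn ℝ D r) (hu : u ∈ D)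
    (h : ∀ z ∈ D, r u ≤ r z + ⟪g, z - u⟫ + c * ‖z - u‖ ^ 2) (z : E) (hz : z ∈ D) :
    r u + ⟪-g, z - u⟫ ≤ r z := by
  have key : ∀ t : ℝ, 0 < t → t ≤ 1 →
      0 ≤ r z - r u + ⟪g, z - u⟫ + c * t * ‖z - u‖ ^ 2 := by
    intro t ht0 ht1
    have h1 := h _ (hr.1.add_smul_sub_mem hu hz ⟨ht0.le, ht1⟩)
    have h2 := hr.2 hu hz (sub_nonneg.2 ht1) ht0.le (by ring)
    have e : u + t • (z - u) = (1 - t) • u + t • z := by module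
    rw [← e] at h2
    simp only [add_sub_cancel_left, inner_smul_right, norm_smul, Real.norm_eq_abs,
      mul_pow, sq_abs, smul_eq_mul] at h1 h2
    have : 0 ≤ t * (r z - r u + ⟪g, z - u⟫ + c * t * ‖z - u‖ ^ 2) := by nlinarith
    exact nonneg_of_mul_nonneg_right this ht0
  have lim : Filter.Tendsto (fun t : ℝ => r z - r u + ⟪g, z - u⟫ + c * t * ‖z - u‖ ^ 2)
      (nhdsWithin 0 (Set.Ioi 0)) (nhds (r z - r u + ⟪g, z - u⟫ + c * 0 * ‖z - u‖ ^ 2)) := by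
    refine Filter.Tendsto.mono_left ?_ nhdsWithin_le_nhds
    exact Continuous.tendsto (by fun_prop) 0
  have := ge_of_tendsto lim (by
    filter_upwards [Ioc_mem_nhdsGT (zero_lt_one (α := ℝ))] with t ht using key t ht.1 ht.2)
  rw [inner_neg_left]
  simp at this
  linarith

lemma aux_local {f : (∀ i, E i) → ℝ} {g : (∀ i, E i) → ∀ i, E i} {D : ∀ i, Set (E i)}
    {r : ∀ i, E i → ℝ} {L K α : ι → ℝ}
    (hDconv : ∀ i, Convex ℝ (D i)) (hDcomp : ∀ i, IsCompact (D i)) (hLpos : ∀ i, 0 < L i)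
    (hrconv : ∀ i, ConvexOn ℝ (D i) (r i))
    (hrlsc : ∀ i, LowerSemicontinuousOn (r i) (D i))
    (hαpos : ∀ i, 0 < α i)
    (hq : ∀ (u : ∀ i, E i), (∀ j, u j ∈ D j) → ∀ i, ∀ y ∈ D i,
      |f (Function.update u i y) - f u - ⟪g u i, y - u i⟫| ≤ L i * ‖y - u i‖ ^ 2)
    (hlip : ∀ u v : ∀ i, E i, (∀ j, u j ∈ D j) → (∀ j, v j ∈ D j) →
      |f u - f v| ≤ ∑ i, K i * ‖u i - v i‖)
    (hK : ∀ i, ∀ u : ∀ i, E i, (∀ j, u j ∈ D j) → ∀ y ∈ D i,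
      |⟪g u i, y - u i⟫| ≤ K i * ‖y - u i‖)
    (v : ∀ i, E i) (hv : ∀ j, v j ∈ D j) (i : ι)
    (hbad : ∃ z ∈ D i, ¬ (r i (v i) + ⟪-g v i, z - v i⟫ ≤ r i z)) :
    ∃ ε : ℝ, 0 < ε ∧ ∀ u : ∀ i, E i, (∀ j, u j ∈ D j) → dist u v < ε → ∀ w : E i, ‖w‖ < ε →
      ∀ y, IsProxPt (r i) (D i) (α i) (u i - α i • (g u i + w)) y → ε ≤ ‖y - u i‖ := by
  by_contra hcon
  push Not at hcon
  have hpos : ∀ m : ℕ, (0 : ℝ) < 1 / ((m : ℝ) + 1) := fun m => Nat.one_div_pos_of_nat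
  choose u hu hud w hw y hy hyu using fun m : ℕ => hcon (1 / ((m : ℝ) + 1)) (hpos m)
  have h0 := tendsto_one_div_add_atTop_nhds_zero_nat (𝕜 := ℝ)
  have huv : Filter.Tendsto u Filter.atTop (nhds v) :=
    tendsto_iff_dist_tendsto_zero.2
      (squeeze_zero (fun _ => dist_nonneg) (fun m => (hud m).le) h0)
  have hw0 : Filter.Tendsto w Filter.atTop (nhds 0) :=
    squeeze_zero_norm (fun m => (hw m).le) h0
  have hyu0 : Filter.Tendsto (fun m => y m - u m i) Filter.atTop (nhds 0) :=
    squeeze_zero_norm (fun m => (hyu m).le) h0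
  have hui := tendsto_pi_nhds.1 huv i
  have hyv : Filter.Tendsto y Filter.atTop (nhds (v i)) := by
    simpa using hyu0.add hui
  obtain ⟨z, hz, hzbad⟩ := hbad
  refine hzbad (aux_var (c := 1 / (2 * α i)) (hrconv i) (hv i) (fun z hz => ?_) z hz)
  have hg1 := aux_gradlim hDconv hDcomp hLpos hq hlip u v hu hv huv i z hz
  have hg2 : Filter.Tendsto (fun m => ⟪g (u m) i, y m - u m i⟫) Filter.atTop (nhds 0) := by
    refine squeeze_zero_norm (a := fun m => K i * ‖y m - u m i‖)
      (fun m => hK i (u m) (hu m) (y m) (hy m).1) ?_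
    simpa using hyu0.norm.const_mul (K i)
  have hR : Filter.Tendsto (fun m => r i z + ⟪g (u m) i, z - u m i⟫ + ⟪w m, z - u m i⟫ +
      1 / (2 * α i) * ‖z - u m i‖ ^ 2 - ⟪g (u m) i, y m - u m i⟫ - ⟪w m, y m - u m i⟫
      - 1 / (2 * α i) * ‖y m - u m i‖ ^ 2) Filter.atTop
      (nhds (r i z + ⟪g v i, z - v i⟫ + ⟪(0 : E i), z - v i⟫ +
      1 / (2 * α i) * ‖z - v i‖ ^ 2 - 0 - ⟪(0 : E i), (0 : E i)⟫
      - 1 / (2 * α i) * ‖(0 : E i)‖ ^ 2)) := by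
    have hzu := hui.const_sub z
    exact ((((hg1.const_add _).add (hw0.inner hzu)).add ((hzu.norm.pow 2).const_mul _)).sub
      hg2).sub (hw0.inner hyu0) |>.sub ((hyu0.norm.pow 2).const_mul _)
  simp only [inner_zero_left, norm_zero, add_zero, sub_zero, ne_eq, OfNat.ofNat_ne_zero,
    not_false_eq_true, zero_pow, mul_zero] at hR
  refine le_of_forall_lt fun c hc => ?_
  have hl := hrlsc i (v i) (hv i)
  obtain ⟨c', hcc', hc'⟩ := exists_between hc
  have hy2 : Filter.Tendsto y Filter.atTop (nhdsWithin (v i) (D i)) :=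
    tendsto_nhdsWithin_iff.2 ⟨hyv, Filter.Eventually.of_forall fun m => (hy m).1⟩
  refine hcc'.trans_le (ge_of_tendsto hR ?_)
  filter_upwards [hy2.eventually (hl c' hc')] with m hm
  have := aux_prox (hαpos i) (hy m) z hz
  linarith

lemma aux_descent {f : (∀ i, E i) → ℝ} {g : (∀ i, E i) → ∀ i, E i} {D : ∀ i, Set (E i)}
    {r : ∀ i, E i → ℝ} {L α : ι → ℝ} {Fstar : ℝ}
    (hαpos : ∀ i, 0 < α i) (hLpos : ∀ i, 0 < L i) (hα : ∀ i, α i < 1 / (2 * L i))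
    (hq : ∀ (u : ∀ i, E i), (∀ j, u j ∈ D j) → ∀ i, ∀ y ∈ D i,
      |f (Function.update u i y) - f u - ⟪g u i, y - u i⟫| ≤ L i * ‖y - u i‖ ^ 2)
    (hF : ∀ u : ∀ i, E i, (∀ j, u j ∈ D j) → Fstar ≤ f u + ∑ i, r i (u i))
    (x : ℕ → ∀ i, E i) (w : ∀ i, ℕ → E i) (idx : ℕ → ι)
    (hx : ∀ k i, x k i ∈ D i)
    (hup : ∀ k, IsProxPt (r (idx k)) (D (idx k)) (α (idx k))
          (x k (idx k) - α (idx k) • (g (x k) (idx k) + w (idx k) (k + 1))) (x (k + 1) (idx k)) ∧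
        ∀ j, j ≠ idx k → x (k + 1) j = x k j)
    (hw : ∀ i, Summable fun k => ‖w i (k + 1)‖ ^ 2) (i : ι) :
    Filter.Tendsto (fun k => ‖x (k + 1) i - x k i‖) Filter.atTop (nhds 0) := by
  let c : ι → ℝ := fun i => (1 / (2 * α i) - L i) / 2
  have hc : ∀ i, 0 < c i := by
    intro i
    have h1 := hα i
    have h2 : L i < 1 / (2 * α i) := by
      have := hαpos i
      have := hLpos i
      rw [lt_div_iff₀ (by positivity)] at h1 ⊢
      linarith
    simp only [c]
    linarith
  let F : (∀ i, E i) → ℝ := fun u => f u + ∑ i, r i (u i)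
  let a : ℕ → ℝ := fun k => ∑ i, c i * ‖x (k + 1) i - x k i‖ ^ 2
  let b : ℕ → ℝ := fun k => ∑ i, 1 / (4 * c i) * ‖w i (k + 1)‖ ^ 2
  have hb0 : ∀ k, 0 ≤ b k := fun k => Finset.sum_nonneg fun i _ => by
    have := hc i; positivity
  have ha0 : ∀ k, 0 ≤ a k := fun k => Finset.sum_nonneg fun i _ => by
    have := hc i; positivity
  have hbs : Summable b := summable_sum fun i _ => (hw i).mul_left _
  have step : ∀ k, F (x (k + 1)) + a k ≤ F (x k) + b k := by
    intro k
    obtain ⟨h1, h2⟩ := hup k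
    set j := idx k with hj
    have hxe : x (k + 1) = Function.update (x k) j (x (k + 1) j) := by
      ext1 l
      by_cases h : l = j
      · subst h; simp
      · simp [h, h2 l h]
    have ha : a k = c j * ‖x (k + 1) j - x k j‖ ^ 2 := by
      refine Finset.sum_eq_single j (fun l _ hl => ?_) (by simp)
      rw [h2 l hl]; simp
    have hb : 1 / (4 * c j) * ‖w j (k + 1)‖ ^ 2 ≤ b k :=
      Finset.single_le_sum (f := fun i => 1 / (4 * c i) * ‖w i (k + 1)‖ ^ 2)
        (fun i _ => by have := hc i; positivity) (Finset.mem_univ j)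
    have hr : ∑ i, r i (x (k + 1) i) = ∑ i, r i (x k i) + (r j (x (k + 1) j) - r j (x k j)) := by
      rw [← sub_eq_iff_eq_add', ← Finset.sum_sub_distrib]
      refine Finset.sum_eq_single j (fun l _ hl => ?_) (by simp)
      rw [h2 l hl]; simp
    have hp := aux_prox (hαpos j) h1 (x k j) (hx k j)
    have hQ := (abs_le.1 (hq (x k) (hx k) j (x (k + 1) j) (hx _ _))).2
    rw [← hxe] at hQ
    simp only [sub_self, inner_zero_right, norm_zero] at hp
    have hin := abs_le.1 (abs_real_inner_le_norm (w j (k + 1)) (x (k + 1) j - x k j))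
    have hy : ‖w j (k + 1)‖ * ‖x (k + 1) j - x k j‖ ≤
        c j * ‖x (k + 1) j - x k j‖ ^ 2 + 1 / (4 * c j) * ‖w j (k + 1)‖ ^ 2 := by
      have hcj := hc j
      have : c j * ‖x (k + 1) j - x k j‖ ^ 2 + 1 / (4 * c j) * ‖w j (k + 1)‖ ^ 2
        - ‖w j (k + 1)‖ * ‖x (k + 1) j - x k j‖
        = c j * (‖x (k + 1) j - x k j‖ - 1 / (2 * c j) * ‖w j (k + 1)‖) ^ 2 := by
        field_simp
        ring
      have h0 : 0 ≤ c j * (‖x (k + 1) j - x k j‖ - 1 / (2 * c j) * ‖w j (k + 1)‖) ^ 2 := by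
        positivity
      linarith
    have hcj : 1 / (2 * α j) * ‖x (k + 1) j - x k j‖ ^ 2 =
        2 * (c j * ‖x (k + 1) j - x k j‖ ^ 2) + L j * ‖x (k + 1) j - x k j‖ ^ 2 := by
      simp only [c]; ring
    simp only [F]
    rw [hr, ha]
    linarith [hin.1]
  have hsum : ∀ n, ∑ k ∈ Finset.range n, a k + F (x n) ≤ F (x 0) + ∑ k ∈ Finset.range n, b k := by
    intro n
    induction n with
    | zero => simp
    | succ n ih =>
      rw [Finset.sum_range_succ, Finset.sum_range_succ]
      linarith [step n]
  have has : Summable a := by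
    refine summable_of_sum_range_le (c := F (x 0) + ∑' k, b k - Fstar) ha0 fun n => ?_
    have h1 := hbs.sum_le_tsum (Finset.range n) (fun k _ => hb0 k)
    have h2 := hF (x n) (hx n)
    have h3 := hsum n
    simp only [F] at h3 ⊢
    linarith
  have h1 := has.tendsto_atTop_zero
  have h2 : Filter.Tendsto (fun k => ‖x (k + 1) i - x k i‖ ^ 2) Filter.atTop (nhds 0) := by
    refine squeeze_zero (g := fun k => a k / c i) (fun _ => by positivity) (fun k => ?_)
      (by simpa using h1.div_const (c i))
    rw [le_div_iff₀ (hc i), mul_comm]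
    exact Finset.single_le_sum (f := fun i => c i * ‖x (k + 1) i - x k i‖ ^ 2)
        (fun i _ => by have := hc i; positivity) (Finset.mem_univ i)
  have h3 := h2.sqrt
  simpa [Real.sqrt_sq] using h3

end det

lemma aux_noise {Ω : Type*} {mΩ : MeasurableSpace Ω} {μ : Measure Ω} [IsProbabilityMeasure μ]
    (ℱ : Filtration ℕ mΩ) (h : ℕ → Ω → ℝ) (a : ℕ → Ω → ℝ)
    (hh0 : ∀ k ω, 0 ≤ h k ω) (hhint : ∀ k, Integrable (h k) μ)
    (ha0 : ∀ k ω, 0 ≤ a k ω) (ham : ∀ k, Measurable[ℱ k] (a k))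
    (hle : ∀ k, ∀ᵐ ω ∂μ, (μ[h k|ℱ k]) ω ≤ a k ω)
    (hsum : ∀ᵐ ω ∂μ, Summable fun k => a k ω) :
    ∀ᵐ ω ∂μ, Summable fun k => h k ω := by
  let A : ℕ → ℕ → Set Ω := fun M k => {ω | ∑ j ∈ Finset.range (k + 1), a j ω ≤ (M : ℝ)}
  have hA : ∀ M k, MeasurableSet[ℱ k] (A M k) := by
    intro M k
    refine measurableSet_le (Finset.measurable_fun_sum _ fun j hj => ?_) measurable_const
    exact (ham j).mono (ℱ.mono (by simp at hj; omega)) le_rfl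
  have hA' : ∀ M k, MeasurableSet (A M k) := fun M k => ℱ.le k _ (hA M k)
  have hbd : ∀ M n ω, ∑ k ∈ Finset.range n, (A M k).indicator (a k) ω ≤ (M : ℝ) := by
    intro M n ω
    induction n with
    | zero => simp
    | succ n ih =>
      by_cases hω : ω ∈ A M n
      · refine le_trans (Finset.sum_le_sum fun k _ => ?_) hω
        exact Set.indicator_le_self' (fun _ _ => ha0 _ _) _
      · rw [Finset.sum_range_succ, Set.indicator_of_notMem hω, add_zero]
        exact ih
  have hint : ∀ M k, Integrable ((A M k).indicator (a k)) μ := by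
    intro M k
    refine Integrable.of_bound (C := (M : ℝ))
      (((ham k).mono (ℱ.le k) le_rfl).indicator (hA' M k)).aestronglyMeasurable ?_
    refine Filter.Eventually.of_forall fun ω => ?_
    have h1 : 0 ≤ (A M k).indicator (a k) ω := Set.indicator_nonneg (fun _ _ => ha0 _ _) _
    rw [Real.norm_of_nonneg h1]
    refine le_trans ?_ (hbd M (k + 1) ω)
    exact Finset.single_le_sum (f := fun k => (A M k).indicator (a k) ω)
      (fun k _ => Set.indicator_nonneg (fun _ _ => ha0 _ _) _) (by simp)
  have hM : ∀ M : ℕ, ∀ᵐ ω ∂μ, Summable fun k => (A M k).indicator (h k) ω := by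
    intro M
    have hi : ∀ k, Integrable ((A M k).indicator (h k)) μ := fun k =>
      (hhint k).indicator (hA' M k)
    have hn : ∀ k ω, 0 ≤ (A M k).indicator (h k) ω := fun k ω =>
      Set.indicator_nonneg (fun _ _ => hh0 _ _) _
    have hle2 : ∀ k, ∫ ω, (A M k).indicator (h k) ω ∂μ ≤ ∫ ω, (A M k).indicator (a k) ω ∂μ := by
      intro k
      rw [integral_indicator (hA' M k), ← setIntegral_condExp (ℱ.le k) (hhint k) (hA M k),
        ← integral_indicator (hA' M k)]
      refine integral_mono_ae (integrable_condExp.indicator (hA' M k)) (hint M k) ?_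
      filter_upwards [hle k] with ω hω
      exact Set.indicator_le_indicator hω
    have hs : ∀ n, ∫ ω, ∑ k ∈ Finset.range n, (A M k).indicator (h k) ω ∂μ ≤ M := by
      intro n
      rw [integral_finsetSum _ fun k _ => hi k]
      refine (Finset.sum_le_sum fun k _ => hle2 k).trans ?_
      rw [← integral_finsetSum _ fun k _ => hint M k]
      have := integral_mono (μ := μ) (integrable_finsetSum (Finset.range n) fun k _ => hint M k)
        (integrable_const (M : ℝ)) (fun ω => hbd M n ω)
      simpa using this
    have hl : ∫⁻ ω, ∑' k, ENNReal.ofReal ((A M k).indicator (h k) ω) ∂μ ≤ ENNReal.ofReal M := by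
      rw [lintegral_tsum fun k => (hi k).aestronglyMeasurable.aemeasurable.ennreal_ofReal]
      refine ENNReal.tsum_le_of_sum_range_le fun n => ?_
      rw [← lintegral_finsetSum' _
        fun k _ => (hi k).aestronglyMeasurable.aemeasurable.ennreal_ofReal]
      have : ∀ ω, ∑ k ∈ Finset.range n, ENNReal.ofReal ((A M k).indicator (h k) ω) =
          ENNReal.ofReal (∑ k ∈ Finset.range n, (A M k).indicator (h k) ω) := fun ω =>
        (ENNReal.ofReal_sum_of_nonneg fun k _ => hn k ω).symm
      simp_rw [this]
      rw [← ofReal_integral_eq_lintegral_ofReal (integrable_finsetSum _ fun k _ => hi k)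
        (Filter.Eventually.of_forall fun ω => Finset.sum_nonneg fun k _ => hn k ω)]
      exact ENNReal.ofReal_le_ofReal (hs n)
    have hlt := ae_lt_top' (AEMeasurable.tsum
      fun k => (hi k).aestronglyMeasurable.aemeasurable.ennreal_ofReal)
      (hl.trans_lt ENNReal.ofReal_lt_top).ne
    filter_upwards [hlt] with ω hω
    have := ENNReal.summable_toReal hω.ne
    simpa [ENNReal.toReal_ofReal (hn _ _)] using this
  filter_upwards [ae_all_iff.2 hM, hsum] with ω h1 h2
  obtain ⟨M, hM⟩ := exists_nat_ge (∑' k, a k ω)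
  have hmem : ∀ k, ω ∈ A M k := fun k =>
    (h2.sum_le_tsum _ fun j _ => ha0 j ω).trans hM
  have := h1 M
  simpa [Set.indicator_of_mem (hmem _)] using this

lemma aux_bc {Ω : Type*} {mΩ : MeasurableSpace Ω} {μ : Measure Ω} [IsProbabilityMeasure μ]
    (ℱ : Filtration ℕ mΩ) (U I B : ℕ → Set Ω) (h a : ℕ → Ω → ℝ) (p C : ℝ) (hp : 0 < p)
    (hC : 0 ≤ C)
    (hU : ∀ k, MeasurableSet[ℱ k] (U k)) (hI : ∀ k, MeasurableSet (I k))
    (hIp : ∀ k, μ (I k) = ENNReal.ofReal p)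
    (hind : ∀ k, ∃ m : MeasurableSpace Ω, m ≤ mΩ ∧ MeasurableSet[m] (I k) ∧ Indep m (ℱ k) μ)
    (hB : ∀ k, MeasurableSet[ℱ (k + 1)] (B k))
    (hh0 : ∀ k ω, 0 ≤ h k ω)
    (hhint : ∀ k, Integrable (h k) μ)
    (hle : ∀ k, ∀ᵐ ω ∂μ, (μ[h k|ℱ k]) ω ≤ a k ω)
    (hsum : ∀ᵐ ω ∂μ, Summable fun k => a k ω) (ha0 : ∀ k ω, 0 ≤ a k ω)
    (hinc : ∀ k ω, ω ∈ U k → ω ∈ I k → ω ∉ B k → 1 ≤ C * h k ω) :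
    ∀ᵐ ω ∂μ, (∃ᶠ k in Filter.atTop, ω ∈ U k) → ∃ᶠ k in Filter.atTop, ω ∈ B k := by
  let s : ℕ → Set Ω := fun k => match k with
    | 0 => ∅
    | k + 1 => B k
  have hs : ∀ k, MeasurableSet[ℱ k] (s k) := by
    intro k
    cases k with
    | zero => exact @MeasurableSet.empty _ (ℱ 0)
    | succ k => exact hB k
  have hone : ∀ S : Set Ω, MeasurableSet S → Integrable (S.indicator (1 : Ω → ℝ)) μ := fun S hS =>
    (integrable_const (1 : ℝ)).indicator hS
  have key : ∀ k, ∀ᵐ ω ∂μ, p * (U k).indicator (1 : Ω → ℝ) ω ≤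
      (μ[(B k).indicator (1 : Ω → ℝ)|ℱ k]) ω + C * a k ω := by
    intro k
    have hBk : MeasurableSet (B k) := ℱ.le (k + 1) _ (hB k)
    obtain ⟨m, hm, hmI, hmind⟩ := hind k
    have e1 : μ[(I k).indicator (1 : Ω → ℝ)|ℱ k] =ᵐ[μ] fun _ => p := by
      have := condExp_indep_eq (μ := μ) (f := (I k).indicator (1 : Ω → ℝ)) hm (ℱ.le k)
        (stronglyMeasurable_one.indicator hmI) hmind
      refine this.trans (Filter.Eventually.of_forall fun ω => ?_)
      simp only
      rw [integral_indicator_one (hI k), Measure.real, hIp k, ENNReal.toReal_ofReal hp.le]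
    have e2 := condExp_indicator (m := ℱ k) (hone (I k) (hI k)) (hU k)
    have hci : Integrable (fun ω => C * h k ω) μ := (hhint k).const_mul C
    have e3 : μ[(U k).indicator ((I k).indicator (1 : Ω → ℝ))|ℱ k] ≤ᵐ[μ]
        μ[(B k).indicator (1 : Ω → ℝ) + C • h k|ℱ k] := by
      refine condExp_mono ((hone (I k) (hI k)).indicator (ℱ.le k _ (hU k)))
        ((hone _ hBk).add hci) (Filter.Eventually.of_forall fun ω => ?_)
      have h0 : 0 ≤ C * h k ω := mul_nonneg hC (hh0 k ω)
      simp only [Pi.add_apply, Pi.smul_apply, smul_eq_mul]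
      by_cases h1 : ω ∈ U k
      · by_cases h2 : ω ∈ I k
        · by_cases h3 : ω ∈ B k
          · simp [h1, h2, h3, h0]
          · simpa [h1, h2, h3] using hinc k ω h1 h2 h3
        · simp only [h1, h2, Set.indicator_of_mem, Set.indicator_of_notMem, not_false_eq_true]
          have : 0 ≤ (B k).indicator (1 : Ω → ℝ) ω := Set.indicator_nonneg (by simp) _
          linarith
      · simp only [h1, Set.indicator_of_notMem, not_false_eq_true]
        have : 0 ≤ (B k).indicator (1 : Ω → ℝ) ω := Set.indicator_nonneg (by simp) _
        linarith
    have e4 := condExp_add (m := ℱ k) (hone _ hBk) ((hhint k).smul C)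
    have e5 := condExp_smul (μ := μ) C (h k) (ℱ k)
    filter_upwards [e1, e2, e3, e4, e5, hle k] with ω h1 h2 h3 h4 h5 h6
    rw [h2, h4] at h3
    simp only [Pi.add_apply] at h3
    rw [h5] at h3
    simp only [Pi.smul_apply, smul_eq_mul] at h3
    have h7 : C * (μ[h k|ℱ k]) ω ≤ C * a k ω := mul_le_mul_of_nonneg_left h6 hC
    have h8 : (U k).indicator (μ[(I k).indicator (1 : Ω → ℝ)|ℱ k]) ω =
        p * (U k).indicator (1 : Ω → ℝ) ω := by
      by_cases hω : ω ∈ U k <;> simp [hω, h1]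
    linarith
  filter_upwards [ae_mem_limsup_atTop_iff (ℱ := ℱ) μ hs, ae_all_iff.2 key, hsum] with ω h1 h2 h3 h4
  have hdiv : Filter.Tendsto (fun n => ∑ k ∈ Finset.range n, (U k).indicator (1 : Ω → ℝ) ω)
      Filter.atTop Filter.atTop := by
    have := Set.limsup_eq_tendsto_sum_indicator_atTop (zero_lt_one (α := ℝ)) U
    have h5 : ω ∈ Filter.limsup U Filter.atTop := Filter.mem_limsup_iff_frequently_mem.2 h4
    rw [this] at h5
    exact h5
  have hdiv2 : Filter.Tendsto (fun n => ∑ k ∈ Finset.range n,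
      (μ[(s (k + 1)).indicator (1 : Ω → ℝ)|ℱ k]) ω) Filter.atTop Filter.atTop := by
    refine Filter.tendsto_atTop_mono (fun n => ?_)
      (Filter.tendsto_atTop_add_const_right _ (-(C * ∑' k, a k ω)) (hdiv.const_mul_atTop hp))
    have h5 := Finset.sum_le_sum (s := Finset.range n) fun k _ => h2 k
    rw [Finset.sum_add_distrib, ← Finset.mul_sum, ← Finset.mul_sum] at h5
    have h6 := h3.sum_le_tsum (Finset.range n) (fun k _ => ha0 k ω)
    have h7 := mul_le_mul_of_nonneg_left h6 hC
    simp only [s]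
    linarith
  have h6 := Filter.mem_limsup_iff_frequently_mem.1 (h1.2 hdiv2)
  rw [Filter.frequently_atTop] at h6 ⊢
  intro n
  obtain ⟨k, hk, hks⟩ := h6 (n + 1)
  obtain ⟨k, rfl⟩ : ∃ l, k = l + 1 := ⟨k - 1, by omega⟩
  exact ⟨k, by omega, hks⟩

/-- Almost sure convergence to stationary points (Theorem 1 of the paper): if
`0 < α_i < 1/(2L_i)` and `∑_k 1/N_i(k) < ∞` a.s. for each `i`, then for almost every sample
path, every cluster point `x̂` of `{x(k)}` is a stationary point of the problem, i.e.
`0 ∈ ∇f̄(x̂) + ∂r(x̂)` (the subgradient inequality holds for `g = -∇f̄(x̂)`). -/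
theorem stmt3
    {n : ℕ} {d : Fin n → ℕ}
    {Ω : Type*} {mΩ : MeasurableSpace Ω} {μ : Measure Ω} [IsProbabilityMeasure μ]
    (ℱ : Filtration ℕ mΩ)
    (fbar : (∀ i, EuclideanSpace ℝ (Fin (d i))) → ℝ)
    (gradf : (∀ i, EuclideanSpace ℝ (Fin (d i))) → ∀ i, EuclideanSpace ℝ (Fin (d i)))
    (r : ∀ i, EuclideanSpace ℝ (Fin (d i)) → ℝ)
    (D : ∀ i, Set (EuclideanSpace ℝ (Fin (d i))))
    (L α p : Fin n → ℝ) (σ : ℝ) (hσ : 0 < σ) (Fstar : ℝ)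
    (x : ℕ → Ω → ∀ i, EuclideanSpace ℝ (Fin (d i)))
    (w : ∀ i : Fin n, ℕ → Ω → EuclideanSpace ℝ (Fin (d i)))
    (idx : ℕ → Ω → Fin n)
    (N : Fin n → ℕ → Ω → ℕ)
    -- the regularizers: proper lsc convex with compact effective domain
    (hDconv : ∀ i, Convex ℝ (D i)) (hDcomp : ∀ i, IsCompact (D i))
    (hDne : ∀ i, (D i).Nonempty)
    (hrconv : ∀ i, ConvexOn ℝ (D i) (r i))
    (hrlsc : ∀ i, LowerSemicontinuousOn (r i) (D i))
    -- `gradf u i` is the block partial gradient `∇_{x_i} f̄(u)`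
    (hgrad : ∀ (u : ∀ i, EuclideanSpace ℝ (Fin (d i))) (i : Fin n),
      HasGradientAt (fun t => fbar (Function.update u i t)) (gradf u i) (u i))
    (hLpos : ∀ i, 0 < L i)
    -- blockwise `L_i`-smoothness of `f̄`
    (hsmooth : ∀ (u : ∀ i, EuclideanSpace ℝ (Fin (d i))), (∀ j, u j ∈ D j) →
      ∀ i, ∀ ui' ∈ D i, ‖gradf u i - gradf (Function.update u i ui') i‖ ≤ L i * ‖u i - ui'‖)
    -- `F` attains its minimum value `F*` on the effective domain
    (hFstar : IsLeast ((fun u => fbar u + ∑ i, r i (u i)) '' {u | ∀ j, u j ∈ D j}) Fstar)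
    (hp : ∀ i, 0 < p i ∧ p i < 1) (hpsum : ∑ i, p i = 1)
    (hαpos : ∀ i, 0 < α i)
    -- the iterates stay in the effective domain and are adapted
    (hxdom : ∀ k ω i, x k ω i ∈ D i)
    (hadapt : ∀ k, StronglyMeasurable[ℱ k] (x k))
    -- block selection: `P(i_k = i) = p_i`, independent of `ℱ_k`
    (hidxmeas : ∀ k, Measurable (idx k))
    (hidxdist : ∀ k i, μ {ω | idx k ω = i} = ENNReal.ofReal (p i))
    (hidxindep : ∀ k, Indep (MeasurableSpace.comap (idx k) inferInstance) (ℱ k) μ)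
    -- batch sizes: positive and adapted
    (hNpos : ∀ i k ω, 0 < N i k ω)
    (hNadapt : ∀ i k, Measurable[ℱ k] (N i k))
    -- noise: `E[‖w_i(k+1)‖² | ℱ_k] ≤ σ²/N_i(k)` a.s.
    (hnoise : ∀ (i : Fin n) (k : ℕ), ∀ᵐ ω ∂μ,
      (μ[fun ω' => ‖w i (k + 1) ω'‖ ^ 2|ℱ k]) ω ≤ σ ^ 2 / (N i k ω : ℝ))
    (hwint : ∀ (i : Fin n) (k : ℕ), Integrable (fun ω => ‖w i (k + 1) ω‖ ^ 2) μ)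
    -- the update: chosen block does a proximal stochastic-gradient step, others stay put
    (hupdate : ∀ (k : ℕ) (ω : Ω),
      IsProxPt (r (idx k ω)) (D (idx k ω)) (α (idx k ω))
          (x k ω (idx k ω) -
            α (idx k ω) • (gradf (x k ω) (idx k ω) + w (idx k ω) (k + 1) ω))
          (x (k + 1) ω (idx k ω)) ∧
        ∀ j, j ≠ idx k ω → x (k + 1) ω j = x k ω j)
    (hFint : ∀ k, Integrable (fun ω => fbar (x k ω) + ∑ i, r i (x k ω i)) μ)
    -- steplength and batch-size conditions
    (hα : ∀ i, α i < 1 / (2 * L i))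
    (hNsum : ∀ᵐ ω ∂μ, ∀ i, Summable fun k => (1 : ℝ) / (N i k ω : ℝ)) :
    ∀ᵐ ω ∂μ, ∀ xhat : ∀ i, EuclideanSpace ℝ (Fin (d i)),
      MapClusterPt xhat Filter.atTop (fun k => x k ω) →
        ∀ z : ∀ i, EuclideanSpace ℝ (Fin (d i)), (∀ j, z j ∈ D j) →
          (∑ i, r i (xhat i)) + ∑ i, ⟪-gradf xhat i, z i - xhat i⟫ ≤ ∑ i, r i (z i) := by
  have hq : ∀ (u : ∀ i, EuclideanSpace ℝ (Fin (d i))), (∀ j, u j ∈ D j) → ∀ i, ∀ y ∈ D i,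
      |fbar (Function.update u i y) - fbar u - ⟪gradf u i, y - u i⟫| ≤ L i * ‖y - u i‖ ^ 2 :=
    fun u hu i y hy => aux_quad hDconv hgrad hLpos hsmooth u hu i y hy
  choose K hK0 hK using fun i => aux_lip1 hDcomp hDne hLpos hsmooth hq i
  have hlip := aux_lip (f := fbar) (D := D) (K := K) (fun i u hu y hy => (hK i u hu y hy).2)
  have hF : ∀ u : ∀ i, EuclideanSpace ℝ (Fin (d i)), (∀ j, u j ∈ D j) →
      Fstar ≤ fbar u + ∑ i, r i (u i) := fun u hu => hFstar.2 ⟨u, hu, rfl⟩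
  have hasum : ∀ i, ∀ᵐ ω ∂μ, Summable fun k => σ ^ 2 / (N i k ω : ℝ) := by
    intro i
    filter_upwards [hNsum] with ω hω
    simpa [div_eq_mul_inv] using (hω i).mul_left (σ ^ 2)
  have ha0 : ∀ i k ω, 0 ≤ σ ^ 2 / (N i k ω : ℝ) := fun i k ω => by positivity
  have ham : ∀ i k, Measurable[ℱ k] (fun ω => σ ^ 2 / (N i k ω : ℝ)) := by
    intro i k
    exact (measurable_from_top (f := fun m : ℕ => σ ^ 2 / (m : ℝ))).comp (hNadapt i k)
  have hw : ∀ i, ∀ᵐ ω ∂μ, Summable fun k => ‖w i (k + 1) ω‖ ^ 2 := fun i =>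
    aux_noise ℱ (fun k ω => ‖w i (k + 1) ω‖ ^ 2) (fun k ω => σ ^ 2 / (N i k ω : ℝ))
      (fun k ω => by positivity) (hwint i) (ha0 i) (ham i) (hnoise i) (hasum i)
  have hsm : ∀ k i, StronglyMeasurable[ℱ k] (fun ω => x k ω i) := fun k i =>
    (continuous_apply i).comp_stronglyMeasurable (hadapt k)
  let q := TopologicalSpace.denseSeq (∀ i, EuclideanSpace ℝ (Fin (d i)))
  let good : Fin n → ℕ → ℕ → Prop := fun i l m =>
    ∀ u : ∀ i, EuclideanSpace ℝ (Fin (d i)), (∀ j, u j ∈ D j) → dist u (q l) < 1 / ((m : ℝ) + 1) →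
      ∀ v : EuclideanSpace ℝ (Fin (d i)), ‖v‖ < 1 / ((m : ℝ) + 1) →
      ∀ y, IsProxPt (r i) (D i) (α i) (u i - α i • (gradf u i + v)) y →
        1 / ((m : ℝ) + 1) ≤ ‖y - u i‖
  have hbc : ∀ i l m, good i l m → ∀ᵐ ω ∂μ,
      (∃ᶠ k in Filter.atTop, dist (x k ω) (q l) < 1 / ((m : ℝ) + 1)) →
      ∃ᶠ k in Filter.atTop, 1 / ((m : ℝ) + 1) ≤ ‖x (k + 1) ω i - x k ω i‖ := by
    intro i l m hg
    have hε : (0 : ℝ) < 1 / ((m : ℝ) + 1) := Nat.one_div_pos_of_nat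
    set ε : ℝ := 1 / ((m : ℝ) + 1) with hεdef
    refine aux_bc ℱ (fun k => {ω | dist (x k ω) (q l) < ε}) (fun k => {ω | idx k ω = i})
      (fun k => {ω | ε ≤ ‖x (k + 1) ω i - x k ω i‖})
      (fun k ω => ‖w i (k + 1) ω‖ ^ 2) (fun k ω => σ ^ 2 / (N i k ω : ℝ)) (p i) (1 / ε ^ 2)
      (hp i).1 (by positivity) ?_ ?_ (fun k => hidxdist k i) ?_ ?_ (fun k ω => by positivity)
      (hwint i) (hnoise i) (hasum i) (ha0 i) ?_
    · intro k
      exact StronglyMeasurable.measurableSet_lt ((hadapt k).dist stronglyMeasurable_const)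
        stronglyMeasurable_const
    · intro k
      exact hidxmeas k (MeasurableSet.singleton i)
    · intro k
      exact ⟨_, (hidxmeas k).comap_le, ⟨{i}, MeasurableSet.singleton i, rfl⟩, hidxindep k⟩
    · intro k
      exact StronglyMeasurable.measurableSet_le stronglyMeasurable_const
        ((hsm (k + 1) i).sub ((hsm k i).mono (ℱ.mono (Nat.le_succ k)))).norm
    · intro k ω h1 h2 h3
      simp only [Set.mem_setOf_eq] at h1 h2 h3
      have h4 := (hupdate k ω).1
      rw [h2] at h4
      by_contra h5
      refine h3 (hg (x k ω) (hxdom k ω) h1 (w i (k + 1) ω) ?_ _ h4)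
      by_contra h6
      apply h5
      rw [one_div_mul_eq_div, le_div_iff₀ (by positivity), one_mul]
      exact pow_le_pow_left₀ hε.le (not_lt.1 h6) 2
  have hbc' : ∀ᵐ ω ∂μ, ∀ i l m, good i l m →
      (∃ᶠ k in Filter.atTop, dist (x k ω) (q l) < 1 / ((m : ℝ) + 1)) →
      ∃ᶠ k in Filter.atTop, 1 / ((m : ℝ) + 1) ≤ ‖x (k + 1) ω i - x k ω i‖ := by
    refine ae_all_iff.2 fun i => ae_all_iff.2 fun l => ae_all_iff.2 fun m => ?_
    by_cases hg : good i l m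
    · filter_upwards [hbc i l m hg] with ω hω _ using hω
    · exact Filter.Eventually.of_forall fun ω h => absurd h hg
  filter_upwards [hbc', ae_all_iff.2 hw] with ω hω hwω xhat hcl z hz
  have hxhat : ∀ j, xhat j ∈ D j := by
    have hclosed : IsClosed {u : ∀ i, EuclideanSpace ℝ (Fin (d i)) | ∀ j, u j ∈ D j} := by
      have : {u : ∀ i, EuclideanSpace ℝ (Fin (d i)) | ∀ j, u j ∈ D j} = Set.univ.pi D := by
        ext u; simp
      rw [this]
      exact isClosed_set_pi fun j _ => (hDcomp j).isClosed
    by_contra hnot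
    have := hcl.frequently (hclosed.isOpen_compl.mem_nhds hnot)
    obtain ⟨k, hk⟩ := this.exists
    exact hk (hxdom k ω)
  have hblock : ∀ i, r i (xhat i) + ⟪-gradf xhat i, z i - xhat i⟫ ≤ r i (z i) := by
    intro i
    by_contra hbad
    obtain ⟨ε, hε, hloc⟩ := aux_local hDconv hDcomp hLpos hrconv hrlsc hαpos hq hlip
      (fun i u hu y hy => (hK i u hu y hy).1) xhat hxhat i ⟨z i, hz i, hbad⟩
    obtain ⟨m, hm⟩ := exists_nat_one_div_lt (half_pos hε)
    have hm0 : (0 : ℝ) < 1 / ((m : ℝ) + 1) := Nat.one_div_pos_of_nat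
    obtain ⟨l, hl⟩ := (TopologicalSpace.denseRange_denseSeq
      (∀ i, EuclideanSpace ℝ (Fin (d i)))).exists_dist_lt xhat hm0
    have hg : good i l m := by
      intro u hu hud v hv y hy
      have hd : dist u xhat < ε := by
        have := dist_triangle u (q l) xhat
        rw [dist_comm (q l) xhat] at this
        have h2 : dist xhat (q l) < 1 / ((m : ℝ) + 1) := hl
        linarith
      have := hloc u hu hd v (by linarith) y hy
      linarith
    have hfreq := hω i l m hg
      (hcl.frequently (Metric.isOpen_ball.mem_nhds (show xhat ∈ Metric.ball (q l) _ from hl)))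
    have htend := aux_descent hαpos hLpos hα hq hF (fun k => x k ω) (fun i k => w i k ω)
      (fun k => idx k ω) (fun k i => hxdom k ω i) (fun k => hupdate k ω) hwω i
    have hev := htend.eventually (gt_mem_nhds hm0)
    obtain ⟨k, hk1, hk2⟩ := (hfreq.and_eventually hev).exists
    exact absurd hk2 (not_lt.2 hk1)
  rw [← Finset.sum_add_distrib]
  exact Finset.sum_le_sum fun i _ => hblock i

end
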